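/- Let N ≥ 1 with local dimensions n_1,…,n_N, E = E_1 × ⋯ × E_N with E_i = ℝ^{n_i} and the ℓ² product norm, and 𝐄 = E^N with the ℓ² product norm. Let F : E → E be μ-strongly monotone (μ > 0) and θ₀-Lipschitz continuous, let the extended map 𝐅 : 𝐄 → E, (𝐅(𝐱))_i := (F(𝐱^i))_i, be θ-Lipschitz continuous (θ > 0), and define G : 𝐄 → 𝐄 by letting (G(𝐱))^i ∈ E be the vector whose i-th block equals (F(𝐱^i))_i and whose other blocks are zero. Let L be a real symmetric N×N matrix with zero row sums (L·𝟏 = 0), and suppose there is λ₂ > 0 such that ⟨𝐯, L_x𝐯⟩ ≥ λ₂‖𝐯‖² for every 𝐯 ∈ 𝐄 with Σ_{i=1}^N 𝐯^i = 0, where (L_x𝐯)^i := Σ_j L_{ij}𝐯^j. Set a := μ/N, b := (θ₀+θ)/(2√N), and assume c > ((θ₀ + θ)² + 4μθ)/(4μλ₂); set d := cλ₂ − θ and λ_min(M) := (a + d)/2 − √(((a − d)/2)² + b²). Then for every 𝐱 ∈ 𝐄 and every consensual 𝐱′ ∈ 𝐄 (i.e. 𝐱′ = (x′, x′, …, x′)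 for some x′ ∈ E): ⟨𝐱 − 𝐱′, G(𝐱) − G(𝐱′) + c·L_x(𝐱 − 𝐱′)⟩ ≥ λ_min(M)·‖𝐱 − 𝐱′‖². -/

import Mathlib

open scoped RealInnerProductSpace

/-- `E = E_1 × ⋯ × E_N` with `E_i = ℝ^{n_i}` and the ℓ² product norm. -/
noncomputable abbrev ESp (N : ℕ) (n : Fin N → ℕ) :=
  PiLp 2 (fun i : Fin N => EuclideanSpace ℝ (Fin (n i)))

/-- `𝐄 = E^N` with the ℓ² product norm. -/
noncomputable abbrev bESp (N : ℕ) (n : Fin N → ℕ) :=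
  PiLp 2 (fun _ : Fin N => ESp N n)

/-- A quadratic form with matrix `[[a, -b], [-b, d]]` is bounded below by its smallest eigenvalue. -/
theorem min_eigenvalue_mul_le_quadratic_form (a b d s t : ℝ) :
    ((a + d) / 2 - Real.sqrt (((a - d) / 2) ^ 2 + b ^ 2)) * (s ^ 2 + t ^ 2) ≤
      a * s ^ 2 - 2 * b * (s * t) + d * t ^ 2 := by
  set R := Real.sqrt (((a - d) / 2) ^ 2 + b ^ 2)
  have hR2 : R ^ 2 = ((a - d) / 2) ^ 2 + b ^ 2 := Real.sq_sqrt (by positivity)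
  have hle : |(a - d) / 2| ≤ R := Real.abs_le_sqrt (by nlinarith [sq_nonneg b])
  obtain ⟨h1, h2⟩ := abs_le.mp hle
  have hp : 0 ≤ R + (a - d) / 2 := by linarith
  have hq : 0 ≤ R - (a - d) / 2 := by linarith
  have key : 2 * (b * (s * t)) ≤
      (R + (a - d) / 2) * s ^ 2 + (R - (a - d) / 2) * t ^ 2 := by
    refine le_of_abs_le (abs_le_of_sq_le_sq ?_ (by positivity))
    have : b ^ 2 = (R + (a - d) / 2) * (R - (a - d) / 2) := by linarith
    have hsq := sq_nonneg ((R + (a - d) / 2) * s ^ 2 - (R - (a - d) / 2) * t ^ 2)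
    calc (2 * (b * (s * t))) ^ 2 = 4 * b ^ 2 * (s ^ 2 * t ^ 2) := by ring
      _ ≤ _ := by rw [this]; linarith
  linarith

section Consensus

variable {N : ℕ} {n : Fin N → ℕ}

/-- The consensual point `(x, …, x)`. -/
noncomputable def consensus (x : ESp N n) : bESp N n := WithLp.toLp 2 fun _ => x

/-- The diagonal blocks `(v^i_i)_i` of a point of `𝐄`. -/
noncomputable def diagBlocks (V : bESp N n) : ESp N n := WithLp.toLp 2 fun i => V i i

@[simp] theorem consensus_apply (x : ESp N n) (i : Fin N) : consensus x i = x := rfl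

@[simp] theorem diagBlocks_apply (V : bESp N n) (i : Fin N) : diagBlocks V i = V i i := rfl

theorem norm_diagBlocks_le (V : bESp N n) : ‖diagBlocks V‖ ≤ ‖V‖ := by
  refine (sq_le_sq₀ (norm_nonneg _) (norm_nonneg _)).mp ?_
  rw [PiLp.norm_sq_eq_of_L2, PiLp.norm_sq_eq_of_L2]
  refine Finset.sum_le_sum fun i _ => ?_
  rw [diagBlocks_apply, PiLp.norm_sq_eq_of_L2 _ (V i)]
  exact Finset.single_le_sum (f := fun j => ‖V i j‖ ^ 2) (fun j _ => sq_nonneg _)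
    (Finset.mem_univ i)

theorem inner_consensus_left (w : ESp N n) (V : bESp N n) :
    ⟪consensus w, V⟫ = ⟪w, ∑ i, V i⟫ := by
  rw [PiLp.inner_apply, inner_sum]
  rfl

theorem norm_consensus_add_sq (w : ESp N n) (V : bESp N n) (hV : ∑ i, V i = 0) :
    ‖consensus w + V‖ ^ 2 = N * ‖w‖ ^ 2 + ‖V‖ ^ 2 := by
  have h : ‖consensus w‖ ^ 2 = N * ‖w‖ ^ 2 := by
    rw [PiLp.norm_sq_eq_of_L2]
    simp
  rw [norm_add_sq_real, inner_consensus_left, hV, inner_zero_right, h]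
  ring

theorem exists_eq_consensus_add (hN : 1 ≤ N) (V : bESp N n) :
    ∃ (w : ESp N n) (U : bESp N n), V = consensus w + U ∧ ∑ i, U i = 0 := by
  have hN' : (N : ℝ) ≠ 0 := by positivity
  refine ⟨(N : ℝ)⁻¹ • ∑ i, V i, V - consensus ((N : ℝ)⁻¹ • ∑ i, V i), by abel, ?_⟩
  simp only [PiLp.sub_apply, consensus_apply, Finset.sum_sub_distrib, Finset.sum_const,
    Finset.card_univ, Fintype.card_fin]
  rw [← Nat.cast_smul_eq_nsmul ℝ, smul_inv_smul₀ hN', sub_self]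

/-- A point whose off-diagonal blocks vanish pairs only with diagonal blocks. -/
theorem inner_of_diagonal (V Y : bESp N n) (hY : ∀ i j, j ≠ i → Y i j = 0) :
    ⟪V, Y⟫ = ⟪diagBlocks V, diagBlocks Y⟫ := by
  rw [PiLp.inner_apply, PiLp.inner_apply]
  refine Finset.sum_congr rfl fun i _ => ?_
  rw [PiLp.inner_apply, Finset.sum_eq_single i]
  · rfl
  · intro j _ hj
    rw [hY i j hj, inner_zero_right]
  · simp

/-- A symmetric block action with zero row sums sees only the disagreement component. -/
theorem inner_consensus_add_laplacian {L : Matrix (Fin N) (Fin N) ℝ} (hL : L.IsSymm)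
    (hrow : ∀ i, ∑ j, L i j = 0) {Lx : bESp N n → bESp N n}
    (hLx : ∀ V i, Lx V i = ∑ j, L i j • V j) (w : ESp N n) (U : bESp N n) :
    ⟪consensus w + U, Lx (consensus w + U)⟫ = ⟪U, Lx U⟫ := by
  have h1 : Lx (consensus w + U) = Lx U := by
    refine PiLp.ext fun i => ?_
    rw [hLx, hLx]
    simp only [PiLp.add_apply, consensus_apply, smul_add, Finset.sum_add_distrib]
    rw [← Finset.sum_smul, hrow, zero_smul, zero_add]
  have h2 : ∑ i, Lx U i = 0 := by
    simp only [hLx]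
    rw [Finset.sum_comm]
    refine Finset.sum_eq_zero fun j _ => ?_
    have : ∑ i, L i j = 0 := by
      rw [← hrow j]
      exact Finset.sum_congr rfl fun i _ => hL.apply j i
    rw [← Finset.sum_smul, this, zero_smul]
  rw [h1, inner_add_left, inner_consensus_left, h2, inner_zero_right, zero_add]

end Consensus

theorem stmt7 {N : ℕ} (hN : 1 ≤ N) (n : Fin N → ℕ)
    (μ θ₀ θ c lam₂ : ℝ) (hμ : 0 < μ) (hθ₀ : 0 ≤ θ₀) (hθ : 0 < θ) (hlam₂ : 0 < lam₂)
    (F : ESp N n → ESp N n)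
    -- `F` is μ-strongly monotone
    (hmon : ∀ x y, μ * ‖x - y‖ ^ 2 ≤ ⟪x - y, F x - F y⟫)
    -- `F` is θ₀-Lipschitz continuous
    (hFlip : ∀ x y, ‖F x - F y‖ ≤ θ₀ * ‖x - y‖)
    -- the extended map `𝐅 : 𝐄 → E`, `(𝐅(𝐱))_i := (F(𝐱^i))_i`, is θ-Lipschitz
    (FF : bESp N n → ESp N n) (hFF : ∀ X i, FF X i = F (X i) i)
    (hFFlip : ∀ X Y, ‖FF X - FF Y‖ ≤ θ * ‖X - Y‖)
    -- `G : 𝐄 → 𝐄`, `(G(𝐱))^i` has `i`-th block `(F(𝐱^i))_i` and other blocks zero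
    (G : bESp N n → bESp N n)
    (hG : ∀ X i, G X i i = F (X i) i ∧ ∀ j, j ≠ i → G X i j = 0)
    -- `L` real symmetric with zero row sums
    (L : Matrix (Fin N) (Fin N) ℝ) (hLsymm : L.IsSymm) (hLrow : ∀ i, ∑ j, L i j = 0)
    -- blockwise action `L_x` of `L` on `𝐄`
    (Lx : bESp N n → bESp N n) (hLx : ∀ V i, Lx V i = ∑ j, L i j • V j)
    -- `⟨𝐯, L_x 𝐯⟩ ≥ λ₂‖𝐯‖²` whenever `Σ_i 𝐯^i = 0`
    (hL2 : ∀ V : bESp N n, (∑ i, V i) = 0 → lam₂ * ‖V‖ ^ 2 ≤ ⟪V, Lx V⟫)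
    -- `c > ((θ₀ + θ)² + 4μθ)/(4μλ₂)`
    (hc : ((θ₀ + θ) ^ 2 + 4 * μ * θ) / (4 * μ * lam₂) < c) :
    -- conclusion, with `λ_min(M) = (a+d)/2 − √(((a−d)/2)² + b²)`,
    -- `a = μ/N`, `b = (θ₀+θ)/(2√N)`, `d = cλ₂ − θ`
    ∀ (X X' : bESp N n) (x' : ESp N n), (∀ i, X' i = x') →
      ((μ / (N : ℝ) + (c * lam₂ - θ)) / 2 -
          Real.sqrt (((μ / (N : ℝ) - (c * lam₂ - θ)) / 2) ^ 2 +
            ((θ₀ + θ) / (2 * Real.sqrt N)) ^ 2)) * ‖X - X'‖ ^ 2 ≤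
        ⟪X - X', G X - G X' + c • Lx (X - X')⟫ := by
  intro X X' x' hX'
  obtain ⟨w, U, hV, hU⟩ := exists_eq_consensus_add hN (X - X')
  have hN0 : (0 : ℝ) < N := by exact_mod_cast hN
  have hsqrt : Real.sqrt N ^ 2 = N := Real.sq_sqrt hN0.le
  have hsqrt0 : Real.sqrt N ≠ 0 := (Real.sqrt_pos.mpr hN0).ne'
  have hc0 : 0 ≤ c := le_trans (by positivity) hc.le
  have hFFcons : ∀ x, FF (consensus x) = F x := fun x => PiLp.ext fun i => by
    rw [hFF, consensus_apply]
  have hXcons : X' = consensus x' := PiLp.ext hX'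
  have hXU : X - consensus (x' + w) = U := by
    have : consensus (x' + w) = X' + consensus w := by rw [hXcons]; rfl
    rw [this, ← sub_sub, hV, add_sub_cancel_left]
  have hdiag : diagBlocks (X - X') = w + diagBlocks U := by
    rw [hV]; rfl
  have hGdiag : diagBlocks (G X - G X') =
      (FF X - F (x' + w)) + (F (x' + w) - F x') := by
    rw [sub_add_sub_cancel, ← hFFcons x', ← hXcons]
    refine PiLp.ext fun i => ?_
    rw [diagBlocks_apply, PiLp.sub_apply, PiLp.sub_apply, PiLp.sub_apply, (hG X i).1,
      (hG X' i).1, hFF, hFF]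
  have hGoff : ∀ i j, j ≠ i → (G X - G X') i j = 0 := fun i j hj => by
    rw [PiLp.sub_apply, PiLp.sub_apply, (hG X i).2 j hj, (hG X' i).2 j hj, sub_zero]
  have hdis : ‖FF X - F (x' + w)‖ ≤ θ * ‖U‖ := by
    rw [← hFFcons, ← hXU]
    exact hFFlip _ _
  have hmean : ‖F (x' + w) - F x'‖ ≤ θ₀ * ‖w‖ := by
    simpa using hFlip (x' + w) x'
  have hmonw : μ * ‖w‖ ^ 2 ≤ ⟪w, F (x' + w) - F x'⟫ := by
    simpa using hmon (x' + w) x'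
  have hcross {u v : ESp N n} {r s : ℝ} (hu : ‖u‖ ≤ r) (hv : ‖v‖ ≤ s) :
      -(r * s) ≤ ⟪u, v⟫ :=
    (neg_le_neg (mul_le_mul hu hv (norm_nonneg v) ((norm_nonneg u).trans hu))).trans
      (neg_le_of_abs_le (abs_real_inner_le_norm u v))
  have hwdis := hcross le_rfl hdis (u := w)
  have hUdis := hcross (norm_diagBlocks_le U) hdis
  have hUmean := hcross (norm_diagBlocks_le U) hmean
  have hlap := mul_le_mul_of_nonneg_left (hL2 U hU) hc0
  have hquad := min_eigenvalue_mul_le_quadratic_form (μ / N) ((θ₀ + θ) / (2 * Real.sqrt N))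
    (c * lam₂ - θ) (Real.sqrt N * ‖w‖) ‖U‖
  have hnorm : ‖X - X'‖ ^ 2 = (Real.sqrt N * ‖w‖) ^ 2 + ‖U‖ ^ 2 := by
    rw [hV, norm_consensus_add_sq w U hU, mul_pow, hsqrt]
  rw [hnorm, inner_add_right, inner_of_diagonal _ _ hGoff, hdiag, hGdiag, hV,
    real_inner_smul_right, inner_consensus_add_laplacian hLsymm hLrow hLx, inner_add_left,
    inner_add_right, inner_add_right]
  refine hquad.trans ?_
  have hmu : μ / N * (Real.sqrt N * ‖w‖) ^ 2 = μ * ‖w‖ ^ 2 := by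
    rw [mul_pow, hsqrt]; field_simp
  have hcoup : 2 * ((θ₀ + θ) / (2 * Real.sqrt N)) * (Real.sqrt N * ‖w‖ * ‖U‖) =
      (θ₀ + θ) * (‖w‖ * ‖U‖) := by
    field_simp
  rw [hmu, hcoup]
  linarith
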